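/- Let (l, r, V) be a finite-dimensional bimodule of a finite-dimensional anti-flexible algebra (A, ·) over a field F of characteristic ≠ 2, and let B = A ⋉_{r*,l*} V* be the semidirect product anti-flexible algebra on A ⊕ V* built from the dual bimodule (r*, l*, V*). Identify a linear map T : V → A with the corresponding element T ∈ A⊗V* ⊆ B⊗B. Then 𝐫 = T − σ(T) is a skew-symmetric solution of the anti-flexible Yang–Baxter equation in B if and only if T is an 𝒪-operator associated to the bimodule (l, r, V), i.e., T(u)·T(v) = T(l(T(u))v + r(T(v))u) for all u, v ∈ V. -/

import Mathlib

open LinearMap Module TensorProduct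

def IsAntiFlexible {F : Type*} [Field F] {A : Type*} [AddCommGroup A] [Module F A]
    (m : A →ₗ[F] A →ₗ[F] A) : Prop :=
  ∀ x y z : A, m (m x y) z - m x (m y z) = m (m z y) x - m z (m y x)

def IsAntiFlexibleBimodule {F : Type*} [Field F] {A : Type*} [AddCommGroup A] [Module F A]
    {V : Type*} [AddCommGroup V] [Module F V]
    (m : A →ₗ[F] A →ₗ[F] A) (l r : A →ₗ[F] V →ₗ[F] V) : Prop :=
  (∀ x y : A, l (m x y) - l x ∘ₗ l y = r x ∘ₗ r y - r (m y x)) ∧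
  (∀ x y : A, l x ∘ₗ r y - r y ∘ₗ l x = l y ∘ₗ r x - r x ∘ₗ l y)

/-- The dual family of operators: `⟨α*(x)u*, v⟩ = ⟨u*, α(x)v⟩`. -/
def dualFamily {F : Type*} [Field F] {A : Type*} [AddCommGroup A] [Module F A]
    {V : Type*} [AddCommGroup V] [Module F V] (α : A →ₗ[F] V →ₗ[F] V) :
    A →ₗ[F] Dual F V →ₗ[F] Dual F V :=
  (Module.Dual.transpose (R := F)) ∘ₗ α

/-- The semidirect product multiplication on `A ⊕ W`. -/
def semidirectMul {F : Type*} [Field F] {A : Type*} [AddCommGroup A] [Module F A]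
    {W : Type*} [AddCommGroup W] [Module F W]
    (m : A →ₗ[F] A →ₗ[F] A) (l r : A →ₗ[F] W →ₗ[F] W) :
    (A × W) →ₗ[F] (A × W) →ₗ[F] (A × W) :=
  LinearMap.mk₂ F (fun p q => (m p.1 q.1, l p.1 q.2 + r q.1 p.2))
    (fun p p' q => by
      simp only [Prod.fst_add, Prod.snd_add, map_add, LinearMap.add_apply, Prod.mk_add_mk,
        Prod.mk.injEq]
      exact ⟨trivial, by abel⟩)
    (fun c p q => by
      simp only [Prod.smul_fst, Prod.smul_snd, map_smul, LinearMap.smul_apply, Prod.smul_mk,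
        Prod.mk.injEq, smul_add])
    (fun p q q' => by
      simp only [Prod.fst_add, Prod.snd_add, map_add, LinearMap.add_apply, Prod.mk_add_mk,
        Prod.mk.injEq]
      exact ⟨trivial, by abel⟩)
    (fun c p q => by
      simp only [Prod.smul_fst, Prod.smul_snd, map_smul, LinearMap.smul_apply, Prod.smul_mk,
        Prod.mk.injEq, smul_add])

section YBE

variable {F : Type*} [Field F] {M : Type*} [AddCommGroup M] [Module F M]

noncomputable def mulMap (m : M →ₗ[F] M →ₗ[F] M) : M ⊗[F] M →ₗ[F] M :=
  TensorProduct.lift m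

noncomputable def prod1213 (m : M →ₗ[F] M →ₗ[F] M) :
    (M ⊗[F] M) ⊗[F] (M ⊗[F] M) →ₗ[F] (M ⊗[F] M) ⊗[F] M :=
  (TensorProduct.assoc F M M M).symm.toLinearMap
    ∘ₗ TensorProduct.map (mulMap m) LinearMap.id
    ∘ₗ (tensorTensorTensorComm F M M M M).toLinearMap

noncomputable def prod1323 (m : M →ₗ[F] M →ₗ[F] M) :
    (M ⊗[F] M) ⊗[F] (M ⊗[F] M) →ₗ[F] (M ⊗[F] M) ⊗[F] M :=
  TensorProduct.map LinearMap.id (mulMap m)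
    ∘ₗ (tensorTensorTensorComm F M M M M).toLinearMap

noncomputable def prod2312 (m : M →ₗ[F] M →ₗ[F] M) :
    (M ⊗[F] M) ⊗[F] (M ⊗[F] M) →ₗ[F] (M ⊗[F] M) ⊗[F] M :=
  TensorProduct.map
      (TensorProduct.map LinearMap.id (mulMap m) ∘ₗ (TensorProduct.assoc F M M M).toLinearMap)
      LinearMap.id
    ∘ₗ (TensorProduct.assoc F (M ⊗[F] M) M M).symm.toLinearMap
    ∘ₗ (tensorTensorTensorComm F M M M M).toLinearMap
    ∘ₗ (TensorProduct.comm F (M ⊗[F] M) (M ⊗[F] M)).toLinearMap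

/-- The anti-flexible Yang–Baxter equation `r₁₂·r₁₃ − r₂₃·r₁₂ + r₁₃·r₂₃ = 0`. -/
def IsAFYBESolution (m : M →ₗ[F] M →ₗ[F] M) (r : M ⊗[F] M) : Prop :=
  prod1213 m (r ⊗ₜ[F] r) - prod2312 m (r ⊗ₜ[F] r) + prod1323 m (r ⊗ₜ[F] r) = 0

end YBE

/-- A linear map `T : V → A` identified with an element of
`A ⊗ V* ⊆ (A ⋉ V*) ⊗ (A ⋉ V*)`. -/
noncomputable def oOperatorTensor {F : Type*} [Field F] {A : Type*} [AddCommGroup A]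
    [Module F A] {V : Type*} [AddCommGroup V] [Module F V]
    [Module.Finite F V] [Module.Free F V]
    (T : V →ₗ[F] A) : (A × Dual F V) ⊗[F] (A × Dual F V) :=
  TensorProduct.map (LinearMap.inl F A (Dual F V)) (LinearMap.inr F A (Dual F V))
    ((TensorProduct.comm F (Dual F V) A) ((dualTensorHomEquiv F V A).symm T))

theorem LinearMap.sum_apply_transpose_coord {F V P ι : Type*} [Field F] [AddCommGroup V]
    [Module F V] [AddCommGroup P] [Module F P] [Fintype ι] (b : Basis ι F V)
    (β : V →ₗ[F] Dual F V →ₗ[F] P) (f : V →ₗ[F] V) :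
    ∑ j, β (b j) (Module.Dual.transpose (R := F) f (b.coord j)) = ∑ j, β (f (b j)) (b.coord j) := by
  have h₁ (j : ι) : Module.Dual.transpose (R := F) f (b.coord j) =
      ∑ k, b.coord j (f (b k)) • b.coord k :=
    (b.sum_dual_apply_smul_coord _).symm
  have h₂ (k : ι) : f (b k) = ∑ j, b.coord j (f (b k)) • b j := (b.sum_repr _).symm
  calc _ = ∑ j, ∑ k, b.coord j (f (b k)) • β (b j) (b.coord k) := by
        simp only [h₁, map_sum, map_smul]
    _ = ∑ k, ∑ j, b.coord j (f (b k)) • β (b j) (b.coord k) := Finset.sum_comm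
    _ = ∑ k, β (f (b k)) (b.coord k) := by
        refine Finset.sum_congr rfl fun k _ => ?_
        conv_rhs => rw [h₂ k]
        simp only [map_sum, map_smul, LinearMap.sum_apply, LinearMap.smul_apply]

section YBEFormulas

variable {F M : Type*} [Field F] [AddCommGroup M] [Module F M] (m : M →ₗ[F] M →ₗ[F] M)
  (a b c d : M)

theorem prod1213_tmul : prod1213 m ((a ⊗ₜ[F] b) ⊗ₜ[F] (c ⊗ₜ[F] d)) = (m a c ⊗ₜ[F] b) ⊗ₜ[F] d :=
  rfl

theorem prod1323_tmul : prod1323 m ((a ⊗ₜ[F] b) ⊗ₜ[F] (c ⊗ₜ[F] d)) = (a ⊗ₜ[F] c) ⊗ₜ[F] m b d :=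
  rfl

theorem prod2312_tmul : prod2312 m ((a ⊗ₜ[F] b) ⊗ₜ[F] (c ⊗ₜ[F] d)) = (c ⊗ₜ[F] m a d) ⊗ₜ[F] b :=
  rfl

end YBEFormulas

section SemidirectYBE

variable {F A V : Type*} [Field F] [AddCommGroup A] [Module F A] [AddCommGroup V] [Module F V]

/-- The bilinear map `(u, v) ↦ T(u)·T(v) - T(l(T(u))v + r(T(v))u)`, which vanishes exactly when
`T` is an `𝒪`-operator. -/
def oOperatorDefect (m : A →ₗ[F] A →ₗ[F] A) (l r : A →ₗ[F] V →ₗ[F] V) (T : V →ₗ[F] A) :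
    V →ₗ[F] V →ₗ[F] A :=
  m.compl₁₂ T T - ((l ∘ₗ T).compr₂ T + (r ∘ₗ T).flip.compr₂ T)

theorem oOperatorDefect_apply (m : A →ₗ[F] A →ₗ[F] A) (l r : A →ₗ[F] V →ₗ[F] V)
    (T : V →ₗ[F] A) (u v : V) :
    oOperatorDefect m l r T u v = m (T u) (T v) - T (l (T u) v + r (T v) u) := by
  simp [oOperatorDefect]

theorem oOperatorDefect_eq_zero_iff (m : A →ₗ[F] A →ₗ[F] A) (l r : A →ₗ[F] V →ₗ[F] V)
    (T : V →ₗ[F] A) :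
    oOperatorDefect m l r T = 0 ↔ ∀ u v : V, m (T u) (T v) = T (l (T u) v + r (T v) u) := by
  simp only [LinearMap.ext_iff, oOperatorDefect_apply, sub_eq_zero, LinearMap.zero_apply]

theorem dualTensorHomEquiv_symm_eq_sum [FiniteDimensional F V] {ι : Type*} [Fintype ι]
    (b : Basis ι F V) (T : V →ₗ[F] A) :
    (dualTensorHomEquiv F V A).symm T = ∑ i, b.coord i ⊗ₜ[F] T (b i) := by
  rw [LinearEquiv.symm_apply_eq]
  refine LinearMap.ext fun v => ?_
  conv_lhs => rw [← b.sum_repr v]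
  simp [-Basis.sum_repr]

theorem oOperatorTensor_eq_sum [FiniteDimensional F V] {ι : Type*} [Fintype ι] (b : Basis ι F V)
    (T : V →ₗ[F] A) :
    oOperatorTensor T = ∑ i, LinearMap.inl F A (Dual F V) (T (b i)) ⊗ₜ[F]
      LinearMap.inr F A (Dual F V) (b.coord i) := by
  rw [oOperatorTensor, dualTensorHomEquiv_symm_eq_sum b]
  simp only [map_sum, TensorProduct.comm_tmul, TensorProduct.map_tmul]

variable {M : Type*} [AddCommGroup M] [Module F M]

theorem comm_sub_comm_self (x : M ⊗[F] M) :
    TensorProduct.comm F M M (x - TensorProduct.comm F M M x) =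
      -(x - TensorProduct.comm F M M x) := by
  rw [map_sub, neg_sub, TensorProduct.comm_comm]

theorem sum_tmul_sub_comm {ι : Type*} [Fintype ι] (f g : ι → M) :
    ∑ i, f i ⊗ₜ[F] g i - TensorProduct.comm F M M (∑ i, f i ⊗ₜ[F] g i) =
      ∑ i, (f i ⊗ₜ[F] g i - g i ⊗ₜ[F] f i) := by
  simp only [map_sum, TensorProduct.comm_tmul, Finset.sum_sub_distrib]

/-- Contraction of the last two legs with `u` and `v`. -/
noncomputable def contractDualLegs (pa : M →ₗ[F] A) (px : M →ₗ[F] Dual F V) (u v : V) :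
    (M ⊗[F] M) ⊗[F] M →ₗ[F] A :=
  (TensorProduct.rid F A).toLinearMap ∘ₗ
    TensorProduct.map
      ((TensorProduct.rid F A).toLinearMap ∘ₗ
        TensorProduct.map pa (Module.Dual.eval F V u ∘ₗ px))
      (Module.Dual.eval F V v ∘ₗ px)

theorem contractDualLegs_tmul (pa : M →ₗ[F] A) (px : M →ₗ[F] Dual F V) (u v : V) (p q s : M) :
    contractDualLegs pa px u v ((p ⊗ₜ[F] q) ⊗ₜ[F] s) = px s v • px q u • pa p := by
  simp [contractDualLegs]

/-- The three legs of the Yang–Baxter expression of `T - σ(T)` are three copies of the defect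
of `T`. Here `ia` and `ix` stand for the inclusions of `A` and `V*` in the semidirect product. -/
theorem afybe_skew_eq_sum {ι : Type*} [Fintype ι] (b : Basis ι F V)
    (m : A →ₗ[F] A →ₗ[F] A) (l r : A →ₗ[F] V →ₗ[F] V) (T : V →ₗ[F] A)
    (μ : M →ₗ[F] M →ₗ[F] M) (ia : A →ₗ[F] M) (ix : Dual F V →ₗ[F] M)
    (haa : ∀ p q, μ (ia p) (ia q) = ia (m p q))
    (hax : ∀ p f, μ (ia p) (ix f) = ix (Module.Dual.transpose (R := F) (r p) f))
    (hxa : ∀ p f, μ (ix f) (ia p) = ix (Module.Dual.transpose (R := F) (l p) f))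
    (hxx : ∀ f g, μ (ix f) (ix g) = 0) (t : M ⊗[F] M)
    (ht : t = ∑ i, (ia (T (b i)) ⊗ₜ[F] ix (b.coord i) - ix (b.coord i) ⊗ₜ[F] ia (T (b i)))) :
    prod1213 μ (t ⊗ₜ[F] t) - prod2312 μ (t ⊗ₜ[F] t) + prod1323 μ (t ⊗ₜ[F] t) =
      ∑ i, ∑ j,
        ((ia (oOperatorDefect m l r T (b i) (b j)) ⊗ₜ[F] ix (b.coord i)) ⊗ₜ[F] ix (b.coord j) +
          (ix (b.coord j) ⊗ₜ[F] ia (oOperatorDefect m l r T (b i) (b j))) ⊗ₜ[F] ix (b.coord i) +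
          (ix (b.coord i) ⊗ₜ[F] ix (b.coord j)) ⊗ₜ[F]
            ia (oOperatorDefect m l r T (b i) (b j))) := by
  have htt (P : (M ⊗[F] M) ⊗[F] (M ⊗[F] M) →ₗ[F] (M ⊗[F] M) ⊗[F] M) :
      P (t ⊗ₜ[F] t) = ∑ i, ∑ j,
        P ((ia (T (b i)) ⊗ₜ[F] ix (b.coord i) - ix (b.coord i) ⊗ₜ[F] ia (T (b i))) ⊗ₜ[F]
          (ia (T (b j)) ⊗ₜ[F] ix (b.coord j) - ix (b.coord j) ⊗ₜ[F] ia (T (b j)))) := by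
    rw [ht, TensorProduct.sum_tmul, map_sum]
    simp only [TensorProduct.tmul_sum, map_sum]
  -- each leg placement of a vector, a covector and a fixed covector `g` is bilinear
  let β : M →ₗ[F] M →ₗ[F] M ⊗[F] M := TensorProduct.mk F M M
  let γ : V →ₗ[F] Dual F V →ₗ[F] M ⊗[F] M := β.compl₁₂ (ia ∘ₗ T) ix
  let δ : Dual F V →ₗ[F] V →ₗ[F] M ⊗[F] M := β.compl₁₂ ix (ia ∘ₗ T)
  let tr (f : V →ₗ[F] V) (x : Dual F V) : Dual F V := Module.Dual.transpose (R := F) f x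
  have e₁ (f : V →ₗ[F] V) (g : Dual F V) :
      ∑ j, (ia (T (b j)) ⊗ₜ[F] ix (tr f (b.coord j))) ⊗ₜ[F] ix g =
        ∑ j, (ia (T (f (b j))) ⊗ₜ[F] ix (b.coord j)) ⊗ₜ[F] ix g :=
    LinearMap.sum_apply_transpose_coord b
      (γ.compr₂ ((TensorProduct.mk F (M ⊗[F] M) M).flip (ix g))) f
  have e₂ (f : V →ₗ[F] V) (g : Dual F V) :
      ∑ j, (ia (T (b j)) ⊗ₜ[F] ix g) ⊗ₜ[F] ix (tr f (b.coord j)) =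
        ∑ j, (ia (T (f (b j))) ⊗ₜ[F] ix g) ⊗ₜ[F] ix (b.coord j) :=
    LinearMap.sum_apply_transpose_coord b
      ((TensorProduct.mk F (M ⊗[F] M) M).compl₁₂ (β.flip (ix g) ∘ₗ ia ∘ₗ T) ix) f
  have e₃ (f : V →ₗ[F] V) (g : Dual F V) :
      ∑ j, (ix (tr f (b.coord j)) ⊗ₜ[F] ia (T (b j))) ⊗ₜ[F] ix g =
        ∑ j, (ix (b.coord j) ⊗ₜ[F] ia (T (f (b j)))) ⊗ₜ[F] ix g :=
    LinearMap.sum_apply_transpose_coord b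
      (δ.flip.compr₂ ((TensorProduct.mk F (M ⊗[F] M) M).flip (ix g))) f
  have e₄ (f : V →ₗ[F] V) (g : Dual F V) :
      ∑ j, (ix g ⊗ₜ[F] ia (T (b j))) ⊗ₜ[F] ix (tr f (b.coord j)) =
        ∑ j, (ix g ⊗ₜ[F] ia (T (f (b j)))) ⊗ₜ[F] ix (b.coord j) :=
    LinearMap.sum_apply_transpose_coord b
      ((TensorProduct.mk F (M ⊗[F] M) M).compl₁₂ (β (ix g) ∘ₗ ia ∘ₗ T) ix) f
  have e₅ (f : V →ₗ[F] V) (g : Dual F V) :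
      ∑ j, (ix (tr f (b.coord j)) ⊗ₜ[F] ix g) ⊗ₜ[F] ia (T (b j)) =
        ∑ j, (ix (b.coord j) ⊗ₜ[F] ix g) ⊗ₜ[F] ia (T (f (b j))) :=
    LinearMap.sum_apply_transpose_coord b
      ((TensorProduct.mk F (M ⊗[F] M) M).compl₁₂ (β.flip (ix g) ∘ₗ ix) (ia ∘ₗ T)).flip f
  have e₆ (f : V →ₗ[F] V) (g : Dual F V) :
      ∑ j, (ix g ⊗ₜ[F] ix (tr f (b.coord j))) ⊗ₜ[F] ia (T (b j)) =
        ∑ j, (ix g ⊗ₜ[F] ix (b.coord j)) ⊗ₜ[F] ia (T (f (b j))) :=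
    LinearMap.sum_apply_transpose_coord b
      ((TensorProduct.mk F (M ⊗[F] M) M).compl₁₂ (β (ix g) ∘ₗ ix) (ia ∘ₗ T)).flip f
  have hr₁ := (Fintype.sum_congr _ _ fun i => e₁ (r (T (b i))) (b.coord i)).trans
    Finset.sum_comm
  have hr₄ := (Fintype.sum_congr _ _ fun i => e₄ (r (T (b i))) (b.coord i)).trans
    Finset.sum_comm
  have hr₅ := (Fintype.sum_congr _ _ fun i => e₅ (r (T (b i))) (b.coord i)).trans
    Finset.sum_comm
  have hl₂ := Finset.sum_comm.trans
    (Fintype.sum_congr _ _ fun i => e₂ (l (T (b i))) (b.coord i))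
  have hl₃ := Finset.sum_comm.trans
    (Fintype.sum_congr _ _ fun i => e₃ (l (T (b i))) (b.coord i))
  have hl₆ := Finset.sum_comm.trans
    (Fintype.sum_congr _ _ fun i => e₆ (l (T (b i))) (b.coord i))
  simp only [tr] at hr₁ hr₄ hr₅ hl₂ hl₃ hl₆
  simp only [htt, TensorProduct.sub_tmul, TensorProduct.tmul_sub, map_sub, prod1213_tmul,
    prod2312_tmul, prod1323_tmul, haa, hax, hxa, hxx, oOperatorDefect_apply, map_add,
    TensorProduct.zero_tmul, TensorProduct.tmul_zero, TensorProduct.add_tmul,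
    TensorProduct.tmul_add, Finset.sum_sub_distrib, Finset.sum_add_distrib, sub_zero, zero_sub,
    Finset.sum_neg_distrib]
  rw [hr₁, hr₄, hr₅, hl₂, hl₃, hl₆]
  abel

theorem isAFYBESolution_skew_iff {ι : Type*} [Fintype ι] (b : Basis ι F V)
    (m : A →ₗ[F] A →ₗ[F] A) (l r : A →ₗ[F] V →ₗ[F] V) (T : V →ₗ[F] A)
    (μ : M →ₗ[F] M →ₗ[F] M) (ia : A →ₗ[F] M) (ix : Dual F V →ₗ[F] M)
    (pa : M →ₗ[F] A) (px : M →ₗ[F] Dual F V)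
    (hpa : ∀ p, pa (ia p) = p) (hpx : ∀ f, px (ix f) = f)
    (hpax : ∀ f, pa (ix f) = 0) (hpxa : ∀ p, px (ia p) = 0)
    (haa : ∀ p q, μ (ia p) (ia q) = ia (m p q))
    (hax : ∀ p f, μ (ia p) (ix f) = ix (Module.Dual.transpose (R := F) (r p) f))
    (hxa : ∀ p f, μ (ix f) (ia p) = ix (Module.Dual.transpose (R := F) (l p) f))
    (hxx : ∀ f g, μ (ix f) (ix g) = 0) (t : M ⊗[F] M)
    (ht : t = ∑ i, (ia (T (b i)) ⊗ₜ[F] ix (b.coord i) - ix (b.coord i) ⊗ₜ[F] ia (T (b i)))) :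
    IsAFYBESolution μ t ↔ oOperatorDefect m l r T = 0 := by
  classical
  rw [IsAFYBESolution, afybe_skew_eq_sum b m l r T μ ia ix haa hax hxa hxx t ht]
  constructor
  · intro h
    refine b.ext fun k => b.ext fun n => ?_
    have h' := congrArg (contractDualLegs pa px (b k) (b n)) h
    simpa [contractDualLegs_tmul, hpa, hpx, hpax, hpxa, Finsupp.single_apply, ite_smul] using h'
  · intro h
    simp [h]

end SemidirectYBE

/-- `𝐫 = T − σ(T)` is a skew-symmetric solution of the anti-flexible
Yang–Baxter equation in the semidirect product `A ⋉_{r*, l*} V*` if and only if `T`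
is an `𝒪`-operator associated to the bimodule `(l, r, V)`. -/
theorem oOperator_iff_afybe_solution_in_semidirect
    {F : Type*} [Field F] {A : Type*} [AddCommGroup A] [Module F A]
    {V : Type*} [AddCommGroup V] [Module F V]
    [FiniteDimensional F A] [FiniteDimensional F V]
    (hchar : (2 : F) ≠ 0)
    (m : A →ₗ[F] A →ₗ[F] A) (hm : IsAntiFlexible m)
    (l r : A →ₗ[F] V →ₗ[F] V) (hlr : IsAntiFlexibleBimodule m l r)
    (T : V →ₗ[F] A) :
    (TensorProduct.comm F (A × Dual F V) (A × Dual F V)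
          (oOperatorTensor T -
            TensorProduct.comm F (A × Dual F V) (A × Dual F V) (oOperatorTensor T)) =
        -(oOperatorTensor T -
            TensorProduct.comm F (A × Dual F V) (A × Dual F V) (oOperatorTensor T)) ∧
      IsAFYBESolution (semidirectMul m (dualFamily r) (dualFamily l))
        (oOperatorTensor T -
          TensorProduct.comm F (A × Dual F V) (A × Dual F V) (oOperatorTensor T))) ↔
      ∀ u v : V, m (T u) (T v) = T (l (T u) v + r (T v) u) := by
  let b := Module.finBasis F V
  rw [← oOperatorDefect_eq_zero_iff, and_iff_right (comm_sub_comm_self _)]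
  refine isAFYBESolution_skew_iff b m l r T _ (LinearMap.inl F A (Dual F V))
    (LinearMap.inr F A (Dual F V)) (LinearMap.fst F A (Dual F V)) (LinearMap.snd F A (Dual F V))
    (fun _ => rfl) (fun _ => rfl) (fun _ => rfl) (fun _ => rfl) (fun p q => ?_) (fun p f => ?_)
    (fun p f => ?_) (fun f g => ?_) _ ?_
  · simp [semidirectMul, LinearMap.inl_apply]
  · simp [semidirectMul, dualFamily, LinearMap.inl_apply, LinearMap.inr_apply]
  · simp [semidirectMul, dualFamily, LinearMap.inl_apply, LinearMap.inr_apply]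
  · simp [semidirectMul, LinearMap.inr_apply]
  · rw [oOperatorTensor_eq_sum b]
    exact sum_tmul_sub_comm _ _
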